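/- Let n ≥ 2 and let K be the Cauchy–Szegő kernel on the quaternionic Heisenberg group 𝓗^{n−1}. Then there exist constants C > 0 and R > 0 such that for every g ∈ 𝓗^{n−1} and every r > 0, there exists a point g_* ∈ 𝓗^{n−1} with ρ(g,g_*) = R·r such that for every g₁ ∈ B(g,r) and every g₂ ∈ B(g_*,r), |K(g₂^{−1}·g₁)| ≥ C·ρ(g₁,g₂)^{−Q}, where B(x,r) = {h : ρ(h,x) < r} and Q = 4n+2. -/

import Mathlib

open Quaternion
noncomputable section

/-- An element of the quaternionic Heisenberg group `𝓗^m = Im ℍ × ℍ^m`,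
modelled as a pair `(t, y)` with `t : ℍ` (required to be purely imaginary via
the hypothesis `t.re = 0` in the theorems below) and `y : Fin m → ℍ`. -/
abbrev QH (m : ℕ) := ℍ[ℝ] × (Fin m → ℍ[ℝ])

/-- The group product `(t,y)·(t',y') = (t + t' + 2 Im⟨y,y'⟩, y + y')`, where
`⟨y,y'⟩ = Σ_l conj(y_l)·y'_l`. -/
def qmul {m : ℕ} (g h : QH m) : QH m :=
  (g.1 + h.1 + 2 * (∑ l, star (g.2 l) * h.2 l).im, g.2 + h.2)

/-- The group inverse `(t,y)⁻¹ = (−t,−y)`. -/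
def qinv {m : ℕ} (g : QH m) : QH m := (-g.1, -g.2)

/-- The homogeneous norm `‖(t,y)‖ = (|y|⁴ + |t|²)^{1/4}`. -/
def hnorm {m : ℕ} (g : QH m) : ℝ :=
  ((∑ l, ‖g.2 l‖ ^ 2) ^ 2 + ‖g.1‖ ^ 2) ^ ((1 : ℝ) / 4)

/-- The quasi-distance `ρ(h,g) = ‖g⁻¹·h‖`. -/
def qdist {m : ℕ} (h g : QH m) : ℝ := hnorm (qmul (qinv g) h)

/-- The dilation `δ_r(t,y) = (r²t, ry)`. -/
def qdil {m : ℕ} (r : ℝ) (g : QH m) : QH m := ((r ^ 2 : ℝ) • g.1, r • g.2)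

/-- The normalized Cauchy–Szegő kernel density: `s(σ)` is the `(2n−2)`-nd
derivative at `x = Re σ` of `x ↦ conj(x + Im σ)·(x² + |Im σ|²)^{−2}`
(i.e. `∂^{2(n−1)}/∂x₁^{2(n−1)}[conj σ/|σ|⁴]` with `c_{n−1} = 1`). -/
def sker (n : ℕ) (σ : ℍ[ℝ]) : ℍ[ℝ] :=
  iteratedDeriv (2 * n - 2)
    (fun x : ℝ => ((x ^ 2 + ‖σ.im‖ ^ 2) ^ 2)⁻¹ • star ((x : ℍ[ℝ]) + σ.im)) σ.re

/-- The Cauchy–Szegő kernel `K(t,y) = s(|y|² + t)` on `𝓗^m`. -/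
def Kker (n : ℕ) {m : ℕ} (g : QH m) : ℍ[ℝ] :=
  sker n (((∑ l, ‖g.2 l‖ ^ 2 : ℝ) : ℍ[ℝ]) + g.1)

open scoped ContDiff

lemma continuousAt_iteratedDeriv_right {E F : Type*} [NormedAddCommGroup E] [NormedSpace ℝ E]
    [NormedAddCommGroup F] [NormedSpace ℝ F] {U : Set (E × ℝ)} (hU : IsOpen U) (k : ℕ) :
    ∀ f : E × ℝ → F, (∀ p ∈ U, ContDiffAt ℝ ∞ f p) → ∀ p ∈ U,
      ContinuousAt (fun q : E × ℝ => iteratedDeriv k (fun x => f (q.1, x)) q.2) p := by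
  induction k with
  | zero =>
    intro f hf p hp
    simpa only [iteratedDeriv_zero, Prod.mk.eta] using (hf p hp).continuousAt
  | succ k ih =>
    intro f hf p hp
    have key := ih (fun q => deriv (fun x => f (q.1, x)) q.2) ?_ p hp
    · simpa only [iteratedDeriv_succ'] using key
    intro q hq
    have hfd : ContDiffAt ℝ ∞ (fun q => fderiv ℝ f q ((0 : E), (1 : ℝ))) q :=
      ((hf q hq).fderiv_right (m := ∞) (by simp)).clm_apply contDiffAt_const
    refine hfd.congr_of_eventuallyEq ?_
    filter_upwards [hU.mem_nhds hq] with z hz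
    have h1 : HasFDerivAt f (fderiv ℝ f z) (z.1, z.2) :=
      ((hf z hz).differentiableAt (by simp)).hasFDerivAt
    exact (h1.comp_hasDerivAt z.2
      ((hasDerivAt_const z.2 z.1).prodMk (hasDerivAt_id z.2))).deriv

lemma iteratedDeriv_comp_mul_left {F : Type*} [NormedAddCommGroup F] [NormedSpace ℝ F]
    (c : ℝ) (f : ℝ → F) (k : ℕ) (x : ℝ) :
    iteratedDeriv k (fun x => f (c * x)) x = c ^ k • iteratedDeriv k f (c * x) := by
  induction k generalizing x with
  | zero => simp
  | succ k ih =>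
    have h : iteratedDeriv k (fun x => f (c * x)) =
        fun x => c ^ k • iteratedDeriv k f (c * x) := funext ih
    rw [iteratedDeriv_succ, h, deriv_fun_const_smul_field, deriv_comp_mul_left c (iteratedDeriv k f) x,
      ← iteratedDeriv_succ, smul_smul, pow_succ]

lemma sker_smul {n : ℕ} (hn : 1 ≤ n) {c : ℝ} (hc : 0 < c) (σ : ℍ[ℝ]) :
    sker n (c • σ) = (c ^ (2 * n + 1))⁻¹ • sker n σ := by
  have h := iteratedDeriv_comp_mul_left c
    (fun x : ℝ => ((x ^ 2 + ‖(c • σ).im‖ ^ 2) ^ 2)⁻¹ • star ((x : ℍ[ℝ]) + (c • σ).im))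
    (2 * n - 2) σ.re
  have hf : (fun x : ℝ => (((c * x) ^ 2 + ‖(c • σ).im‖ ^ 2) ^ 2)⁻¹ •
        star (((c * x : ℝ) : ℍ[ℝ]) + (c • σ).im)) =
      fun x : ℝ => (c ^ 3)⁻¹ • (((x ^ 2 + ‖σ.im‖ ^ 2) ^ 2)⁻¹ • star ((x : ℍ[ℝ]) + σ.im)) := by
    funext x
    have him : (c • σ).im = c • σ.im := by ext <;> simp
    have hst : star (((c * x : ℝ) : ℍ[ℝ]) + c • σ.im) = c • star ((x : ℍ[ℝ]) + σ.im) := by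
      ext <;> simp [mul_comm]
    have hden : (c * x) ^ 2 + (c * ‖σ.im‖) ^ 2 = c ^ 2 * (x ^ 2 + ‖σ.im‖ ^ 2) := by ring
    rw [him, hst, norm_smul, Real.norm_of_nonneg hc.le, hden, smul_smul, smul_smul, mul_pow,
      mul_inv]
    congr 1
    field_simp
  rw [hf, iteratedDeriv_fun_const_smul_field] at h
  have hre : (c • σ).re = c * σ.re := by simp
  have hp : (c ^ (2 * n + 1))⁻¹ = (c ^ (2 * n - 2))⁻¹ * (c ^ 3)⁻¹ := by
    rw [← mul_inv, ← pow_add]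
    congr 2
    omega
  unfold sker
  rw [hre, hp, mul_smul, h, smul_smul, inv_mul_cancel₀ (by positivity), one_smul]

lemma sker_one_ne_zero (n : ℕ) : sker n 1 ≠ 0 := by
  have hf : (fun x : ℝ => ((x ^ 2 + ‖(1 : ℍ[ℝ]).im‖ ^ 2) ^ 2)⁻¹ •
      star ((x : ℍ[ℝ]) + (1 : ℍ[ℝ]).im)) = fun x : ℝ => x ^ (-3 : ℤ) • (1 : ℍ[ℝ]) := by
    funext x
    have h0 : (1 : ℍ[ℝ]).im = 0 := by ext <;> simp
    have h1 : star (x : ℍ[ℝ]) = x • (1 : ℍ[ℝ]) := by ext <;> simp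
    rw [h0, norm_zero, add_zero, h1, smul_smul]
    congr 1
    rcases eq_or_ne x 0 with rfl | hx
    · norm_num [zero_zpow]
    · rw [zpow_neg]
      norm_cast
      field_simp
      ring
  have hc : ContDiffAt ℝ (2 * n - 2 : ℕ) (fun x : ℝ => x ^ (-3 : ℤ)) 1 := by
    simp only [zpow_neg]
    exact (contDiff_id.pow 3).contDiffAt.inv (by norm_num)
  unfold sker
  rw [hf, Quaternion.re_one, iteratedDeriv_smul_const hc, iteratedDeriv_eq_iterate,
    iter_deriv_zpow]
  simp only [one_zpow, mul_one]
  refine smul_ne_zero (Finset.prod_ne_zero_iff.2 fun i _ => ?_) one_ne_zero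
  push_cast
  have : (0 : ℝ) ≤ i := i.cast_nonneg
  linarith

lemma continuousAt_sker_one (n : ℕ) : ContinuousAt (sker n) 1 := by
  let f : ℍ[ℝ] × ℝ → ℍ[ℝ] := fun q =>
    ((q.2 ^ 2 + ‖q.1‖ ^ 2) ^ 2)⁻¹ • star ((q.2 : ℍ[ℝ]) + q.1)
  have hU : IsOpen {q : ℍ[ℝ] × ℝ | 0 < q.2} := isOpen_lt continuous_const continuous_snd
  have hf : ∀ p ∈ {q : ℍ[ℝ] × ℝ | 0 < q.2}, ContDiffAt ℝ ∞ f p := by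
    intro p hp
    have hp' : 0 < p.2 := hp
    have hcoe : ContDiff ℝ ∞ fun q : ℍ[ℝ] × ℝ => (q.2 : ℍ[ℝ]) :=
      (algebraMapCLM ℝ ℍ[ℝ]).contDiff.comp contDiff_snd
    have : StarModule ℝ ℍ[ℝ] := ⟨fun c q => by ext <;> simp⟩
    have hstar : ContDiff ℝ ∞ fun q : ℍ[ℝ] × ℝ => star ((q.2 : ℍ[ℝ]) + q.1) :=
      (starL' ℝ : ℍ[ℝ] ≃L[ℝ] ℍ[ℝ]).contDiff.comp (hcoe.add contDiff_fst)
    have hden : ContDiff ℝ ∞ fun q : ℍ[ℝ] × ℝ => (q.2 ^ 2 + ‖q.1‖ ^ 2) ^ 2 :=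
      ((contDiff_snd.pow 2).add (contDiff_fst.norm_sq ℝ)).pow 2
    exact (hden.contDiffAt.inv (by positivity)).smul hstar.contDiffAt
  have hg : ContinuousAt (fun σ : ℍ[ℝ] => (σ.im, σ.re)) 1 :=
    (Quaternion.continuous_im.prodMk Quaternion.continuous_re).continuousAt
  exact ContinuousAt.comp (f := fun σ : ℍ[ℝ] => (σ.im, σ.re))
    (g := fun q : ℍ[ℝ] × ℝ => iteratedDeriv (2 * n - 2) (fun x => f (q.1, x)) q.2)
    (continuousAt_iteratedDeriv_right hU _ f hf _ (by simp)) hg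

/-- The kernel density has its extremal decay on a cone around the positive real axis. -/
lemma exists_sker_lower_bound {n : ℕ} (hn : 1 ≤ n) :
    ∃ c > 0, ∃ ε > 0, ∀ x : ℝ, 0 < x → ∀ v : ℍ[ℝ], ‖v‖ ≤ ε * x →
      c / x ^ (2 * n + 1) ≤ ‖sker n (x + v)‖ := by
  have hpos : 0 < ‖sker n 1‖ := norm_pos_iff.2 (sker_one_ne_zero n)
  have hev := (continuousAt_sker_one n).norm.eventually (lt_mem_nhds (half_lt_self hpos))
  obtain ⟨δ, hδ, hball⟩ := Metric.eventually_nhds_iff.1 hev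
  refine ⟨‖sker n 1‖ / 2, by positivity, δ / 2, by positivity, fun x hx v hv => ?_⟩
  have hxv : (x : ℍ[ℝ]) + v = x • (1 + x⁻¹ • v) := by
    rw [smul_add, smul_smul, mul_inv_cancel₀ hx.ne', one_smul]
    congr 1
    ext <;> simp
  have hnear : dist (1 + x⁻¹ • v) 1 < δ := by
    rw [dist_eq_norm, add_sub_cancel_left, norm_smul, norm_inv, Real.norm_of_nonneg hx.le,
      inv_mul_lt_iff₀ hx]
    nlinarith [mul_pos hδ hx]
  rw [hxv, sker_smul hn hx, norm_smul, norm_inv, Real.norm_of_nonneg (by positivity),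
    div_eq_inv_mul]
  exact mul_le_mul_of_nonneg_left (hball hnear).le (by positivity)

/-- The imaginary part of the standard quaternionic form on `ℍ^m`. -/
def imForm {m : ℕ} (y z : Fin m → ℍ[ℝ]) : ℍ[ℝ] := (∑ l, star (y l) * z l).im

section imForm

variable {m : ℕ} (x y z : Fin m → ℍ[ℝ])

lemma quaternion_im_add (a b : ℍ[ℝ]) : (a + b).im = a.im + b.im := by ext <;> simp

lemma imForm_add_left : imForm (x + y) z = imForm x z + imForm y z := by
  simp only [imForm, ← quaternion_im_add, ← Finset.sum_add_distrib, Pi.add_apply, star_add, add_mul]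

lemma imForm_swap : imForm y x = -imForm x y := by
  have h : ∑ l, star (y l) * x l = star (∑ l, star (x l) * y l) := by
    simp [star_sum, star_mul]
  rw [imForm, imForm, h]
  generalize ∑ l, star (x l) * y l = q
  ext <;> simp

lemma imForm_add_right : imForm x (y + z) = imForm x y + imForm x z := by
  rw [imForm_swap, imForm_add_left, imForm_swap x y, imForm_swap x z]
  abel

lemma imForm_neg_left : imForm (-x) y = -imForm x y := by
  rw [eq_neg_iff_add_eq_zero, ← imForm_add_left, neg_add_cancel]
  ext <;> simp [imForm]

lemma imForm_neg_right : imForm x (-y) = -imForm x y := by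
  rw [imForm_swap, imForm_neg_left, imForm_swap y x, neg_neg]

lemma imForm_self : imForm x x = 0 := by
  have h := imForm_swap x x
  rw [eq_neg_iff_add_eq_zero, ← two_smul ℝ] at h
  exact (smul_eq_zero.1 h).resolve_left two_ne_zero

lemma norm_im_le_norm (a : ℍ[ℝ]) : ‖a.im‖ ≤ ‖a‖ := by
  refine abs_le_of_sq_le_sq' ?_ (norm_nonneg a) |>.2
  rw [sq, sq, ← Quaternion.normSq_eq_norm_mul_self, ← Quaternion.normSq_eq_norm_mul_self,
    Quaternion.normSq_def', Quaternion.normSq_def']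
  simp
  positivity

lemma norm_imForm_le_sum : ‖imForm x y‖ ≤ ∑ l, ‖x l‖ * ‖y l‖ :=
  (norm_im_le_norm _).trans <| (norm_sum_le _ _).trans_eq <| by simp

lemma norm_imForm_le {A B : ℝ} (hA : 0 ≤ A) (hB : 0 ≤ B) (hx : ∑ l, ‖x l‖ ^ 2 ≤ A ^ 2)
    (hy : ∑ l, ‖y l‖ ^ 2 ≤ B ^ 2) : ‖imForm x y‖ ≤ A * B := by
  refine (norm_imForm_le_sum x y).trans (abs_le_of_sq_le_sq' ?_ (by positivity)).2
  rw [mul_pow]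
  exact (Finset.sum_mul_sq_le_sq_mul_sq _ _ _).trans
    (mul_le_mul hx hy (by positivity) (by positivity))

lemma qmul_fst (g h : QH m) : (qmul g h).1 = g.1 + h.1 + 2 * imForm g.2 h.2 := rfl

/-- The central component of `g₂⁻¹ g₁` in terms of the displacements `a` of `g₁` from `g` and
`b` of `g₂` from `g·(0,u)`. -/
lemma qmul_qinv_fst_eq (g g₁ g₂ : QH m) (u : Fin m → ℍ[ℝ]) :
    (qmul (qinv g₂) g₁).1 = (qmul (qinv g) g₁).1 - (qmul (qinv (qmul g (0, u))) g₂).1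
      + 2 * (imForm (qmul (qinv (qmul g (0, u))) g₂).2 u - imForm u (qmul (qinv g) g₁).2
        - imForm (qmul (qinv (qmul g (0, u))) g₂).2 (qmul (qinv g) g₁).2) := by
  obtain ⟨t, y⟩ := g
  obtain ⟨t₁, y₁⟩ := g₁
  obtain ⟨t₂, y₂⟩ := g₂
  simp only [qinv, qmul, ← imForm.eq_1, imForm_add_left, imForm_add_right,
    imForm_neg_left, imForm_neg_right, imForm_self, imForm_swap y y₂,
    imForm_swap u y, imForm_swap u y₂]
  noncomm_ring

lemma hnorm_pow_four (g : QH m) : hnorm g ^ 4 = (∑ l, ‖g.2 l‖ ^ 2) ^ 2 + ‖g.1‖ ^ 2 := by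
  rw [hnorm, ← Real.rpow_natCast, ← Real.rpow_mul (by positivity)]
  norm_num

lemma hnorm_nonneg (g : QH m) : 0 ≤ hnorm g := by
  unfold hnorm
  positivity

lemma sum_sq_le_hnorm_sq (g : QH m) : ∑ l, ‖g.2 l‖ ^ 2 ≤ hnorm g ^ 2 := by
  refine (abs_le_of_sq_le_sq' ?_ (by positivity)).2
  rw [← pow_mul, hnorm_pow_four]
  exact le_add_of_nonneg_right (by positivity)

lemma norm_fst_le_hnorm_sq (g : QH m) : ‖g.1‖ ≤ hnorm g ^ 2 := by
  refine (abs_le_of_sq_le_sq' ?_ (by positivity)).2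
  rw [← pow_mul, hnorm_pow_four]
  exact le_add_of_nonneg_left (by positivity)

lemma norm_snd_apply_le_hnorm (g : QH m) (i : Fin m) : ‖g.2 i‖ ≤ hnorm g := by
  refine (abs_le_of_sq_le_sq' ?_ (hnorm_nonneg g)).2
  exact (Finset.single_le_sum (f := fun l => ‖g.2 l‖ ^ 2) (fun _ _ => sq_nonneg _)
    (Finset.mem_univ i)).trans (sum_sq_le_hnorm_sq g)

lemma sum_norm_single_sq (i : Fin m) (s : ℝ) :
    ∑ l, ‖(Pi.single i (s : ℍ[ℝ]) : Fin m → ℍ[ℝ]) l‖ ^ 2 = s ^ 2 := by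
  rw [Finset.sum_eq_single i]
  · simp
  · intro j _ hj
    simp [hj]
  · simp

lemma qdist_qmul_single (g : QH m) (i : Fin m) {s : ℝ} (hs : 0 ≤ s) :
    qdist g (qmul g (0, Pi.single i (s : ℍ[ℝ]))) = s := by
  set u : Fin m → ℍ[ℝ] := Pi.single i (s : ℍ[ℝ]) with hu
  have h1 : (qmul (qinv (qmul g (0, u))) g).1 = 0 := by
    simp only [qinv, qmul, ← imForm.eq_1, imForm_add_left, imForm_neg_left, imForm_self,
      imForm_swap u g.2]
    noncomm_ring
  have h2 : (qmul (qinv (qmul g (0, u))) g).2 = -u := by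
    simp [qmul, qinv]
  have h4 : qdist g (qmul g (0, u)) ^ 4 = s ^ 4 := by
    rw [qdist, hnorm_pow_four, h1, h2]
    simp only [Pi.neg_apply, norm_neg, norm_zero, hu, sum_norm_single_sq i s]
    ring
  exact (pow_left_inj₀ (hnorm_nonneg _) hs (by norm_num)).1 h4

/-- Points of a ball and of its far horizontal translate differ by an element close to the
horizontal directions. -/
lemma norm_fst_le_and_sum_ge (g g₁ g₂ : QH m) (i : Fin m) {r R : ℝ} (hr : 0 < r) (hR : 2 ≤ R)
    (h₁ : qdist g₁ g < r)
    (h₂ : qdist g₂ (qmul g (0, Pi.single i ((R * r : ℝ) : ℍ[ℝ]))) < r) :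
    ‖(qmul (qinv g₂) g₁).1‖ ≤ (4 + 4 * R) * r ^ 2 ∧
      ((R - 2) * r) ^ 2 ≤ ∑ l, ‖(qmul (qinv g₂) g₁).2 l‖ ^ 2 := by
  set u : Fin m → ℍ[ℝ] := Pi.single i ((R * r : ℝ) : ℍ[ℝ]) with hu
  set a := qmul (qinv g) g₁ with ha
  set b := qmul (qinv (qmul g (0, u))) g₂ with hb
  have hRr : 0 ≤ R * r := by positivity
  have hna : hnorm a ≤ r := h₁.le
  have hnb : hnorm b ≤ r := h₂.le
  have ha2 := pow_le_pow_left₀ (hnorm_nonneg a) hna 2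
  have hb2 := pow_le_pow_left₀ (hnorm_nonneg b) hnb 2
  have hus : ∑ l, ‖u l‖ ^ 2 ≤ (R * r) ^ 2 := (sum_norm_single_sq i (R * r)).le
  have has := (sum_sq_le_hnorm_sq a).trans ha2
  have hbs := (sum_sq_le_hnorm_sq b).trans hb2
  constructor
  · rw [qmul_qinv_fst_eq g g₁ g₂ u, ← ha, ← hb]
    have e1 := norm_imForm_le b.2 u hr.le hRr hbs hus
    have e2 := norm_imForm_le u a.2 hRr hr.le hus has
    have e3 := norm_imForm_le b.2 a.2 hr.le hr.le hbs has
    have e4 := (norm_fst_le_hnorm_sq a).trans ha2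
    have e5 := (norm_fst_le_hnorm_sq b).trans hb2
    have t1 := norm_add_le (a.1 - b.1) (2 * (imForm b.2 u - imForm u a.2 - imForm b.2 a.2))
    have t2 := norm_sub_le a.1 b.1
    have t3 := norm_sub_le (imForm b.2 u - imForm u a.2) (imForm b.2 a.2)
    have t4 := norm_sub_le (imForm b.2 u) (imForm u a.2)
    have h2 : ‖(2 : ℍ[ℝ])‖ = 2 := by
      have : ((2 : ℝ) : ℍ[ℝ]) = 2 := by norm_cast
      rw [← this, Quaternion.norm_coe, Real.norm_two]
    rw [norm_mul, h2] at t1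
    nlinarith
  · have hy : u i = a.2 i - b.2 i - (qmul (qinv g₂) g₁).2 i := by
      simp only [ha, hb, qmul, qinv, Pi.add_apply, Pi.neg_apply]
      abel
    have hui : ‖u i‖ = R * r := by
      rw [hu, Pi.single_eq_same, Quaternion.norm_coe, Real.norm_of_nonneg hRr]
    have t1 := norm_sub_le (a.2 i - b.2 i) ((qmul (qinv g₂) g₁).2 i)
    have t2 := norm_sub_le (a.2 i) (b.2 i)
    rw [← hy, hui] at t1
    have e1 := (norm_snd_apply_le_hnorm a i).trans hna
    have e2 := (norm_snd_apply_le_hnorm b i).trans hnb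
    have hle : (R - 2) * r ≤ ‖(qmul (qinv g₂) g₁).2 i‖ := by linarith
    exact (pow_le_pow_left₀ (mul_nonneg (by linarith) hr.le) hle 2).trans
      (Finset.single_le_sum (f := fun l => ‖(qmul (qinv g₂) g₁).2 l‖ ^ 2)
        (fun _ _ => sq_nonneg _) (Finset.mem_univ i))

end imForm

/-- Step 3 of the lower-bound theorem (two-ball lower bound): there exist
constants `C > 0` and `R > 0` such that for every `g` and every `r > 0` there
is a point `g_*` with `ρ(g,g_*) = R·r` such that for all `g₁ ∈ B(g,r)` and
`g₂ ∈ B(g_*,r)` one has `|K(g₂⁻¹·g₁)| ≥ C·ρ(g₁,g₂)^{−Q}`, with `Q = 4n+2`. -/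
theorem Kker_two_ball_lower_bound (n : ℕ) (hn : 2 ≤ n) :
    ∃ C : ℝ, 0 < C ∧ ∃ R : ℝ, 0 < R ∧
      ∀ g : QH (n - 1), g.1.re = 0 → ∀ r : ℝ, 0 < r →
        ∃ gs : QH (n - 1), gs.1.re = 0 ∧ qdist g gs = R * r ∧
          ∀ g₁ g₂ : QH (n - 1), g₁.1.re = 0 → g₂.1.re = 0 →
            qdist g₁ g < r → qdist g₂ gs < r →
            ‖Kker n (qmul (qinv g₂) g₁)‖ ≥ C / qdist g₁ g₂ ^ (4 * n + 2) := by
  obtain ⟨c, hc, ε, hε, hs⟩ := exists_sker_lower_bound (n := n) (by omega)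
  have hR : 2 ≤ 5 + 8 / ε := by linarith [div_pos (by norm_num : (0 : ℝ) < 8) hε]
  refine ⟨c, hc, 5 + 8 / ε, by linarith, fun g hg r hr => ?_⟩
  refine ⟨qmul g (0, Pi.single ⟨0, by omega⟩ (((5 + 8 / ε) * r : ℝ) : ℍ[ℝ])), ?_,
    qdist_qmul_single g _ (by positivity), fun g₁ g₂ _ _ h₁ h₂ => ?_⟩
  · simp only [qmul_fst, two_mul, Quaternion.re_add, hg, imForm, Quaternion.re_im]
    simp
  obtain ⟨ht, hy⟩ := norm_fst_le_and_sum_ge g g₁ g₂ _ hr hR h₁ h₂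
  set h := qmul (qinv g₂) g₁ with hh
  have hRε : 4 + 4 * (5 + 8 / ε) ≤ ε * (5 + 8 / ε - 2) ^ 2 := by
    have : 0 < 8 / ε := by positivity
    have h8 : ε * (8 / ε) = 8 := mul_div_cancel₀ 8 hε.ne'
    nlinarith
  have hx : 0 < ∑ l, ‖h.2 l‖ ^ 2 := by
    refine lt_of_lt_of_le (pow_pos (mul_pos ?_ hr) 2) hy
    linarith [div_pos (by norm_num : (0 : ℝ) < 8) hε]
  have hv : ‖h.1‖ ≤ ε * ∑ l, ‖h.2 l‖ ^ 2 := calc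
    ‖h.1‖ ≤ (4 + 4 * (5 + 8 / ε)) * r ^ 2 := ht
    _ ≤ ε * (5 + 8 / ε - 2) ^ 2 * r ^ 2 := by gcongr
    _ = ε * ((5 + 8 / ε - 2) * r) ^ 2 := by ring
    _ ≤ ε * ∑ l, ‖h.2 l‖ ^ 2 := by gcongr
  refine le_trans ?_ (hs _ hx _ hv)
  have hpow : (∑ l, ‖h.2 l‖ ^ 2) ^ (2 * n + 1) ≤ qdist g₁ g₂ ^ (4 * n + 2) := by
    rw [show 4 * n + 2 = 2 * (2 * n + 1) by ring, pow_mul]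
    exact pow_le_pow_left₀ hx.le (sum_sq_le_hnorm_sq h) _
  exact div_le_div_of_nonneg_left hc.le (by positivity) hpow
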